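/- Let X be an n-poised set and let ℓ be a line containing at least 3 and at most n nodes of X. Suppose λ' and λ'' are two maximal lines of X with λ' ∩ λ'' ∩ ℓ ∈ X (λ', λ'' are ℓ-adjacent). Then X_ℓ = (X \ (λ' ∪ λ''))_ℓ, where the latter is the set of nodes of the (n−2)-poised set X \ (λ' ∪ λ'') that use ℓ. Moreover, if ℓ contains exactly n nodes of X, then X_ℓ = X \ (λ' ∪ λ'' ∪ ℓ), and this set is (n−3)-poised. -/

import Mathlib

open MvPolynomial

/-- Bivariate real polynomials. -/
abbrev Poly2 : Type := MvPolynomial (Fin 2) ℝ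

/-- Evaluation of a bivariate polynomial at a point of `ℝ²`. -/
noncomputable def evalPt (p : Poly2) (A : ℝ × ℝ) : ℝ :=
  MvPolynomial.eval (fun i => if i = 0 then A.1 else A.2) p

/-- `X` is an `n`-poised set: it has `(n+2 choose 2)` nodes and the only polynomial of
total degree at most `n` vanishing on all of `X` is the zero polynomial. -/
def IsPoised (n : ℕ) (X : Finset (ℝ × ℝ)) : Prop :=
  X.card = (n + 2).choose 2 ∧
    ∀ p : Poly2, p.totalDegree ≤ n → (∀ A ∈ X, evalPt p A = 0) → p = 0

/-- `p` is an `n`-fundamental polynomial of the node `A` with respect to `X`. -/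
def IsFund (n : ℕ) (X : Finset (ℝ × ℝ)) (A : ℝ × ℝ) (p : Poly2) : Prop :=
  p.totalDegree ≤ n ∧ evalPt p A = 1 ∧ ∀ B ∈ X, B ≠ A → evalPt p B = 0

/-- `X` is a `GC_n` set: `n`-poised and each node has a fundamental polynomial which is
a product of `n` polynomials of degree 1. -/
def IsGC (n : ℕ) (X : Finset (ℝ × ℝ)) : Prop :=
  IsPoised n X ∧
    ∀ A ∈ X, ∃ p : Poly2, IsFund n X A p ∧
      ∃ f : Fin n → Poly2, (∀ i, (f i).totalDegree = 1) ∧ p = ∏ i, f i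

/-- The nodes of `X` lying on the zero set of `ℓ`. -/
noncomputable def nodesOn (X : Finset (ℝ × ℝ)) (ℓ : Poly2) : Finset (ℝ × ℝ) :=
  @Finset.filter _ (fun A => evalPt ℓ A = 0) (Classical.decPred _) X

/-- `ℓ` is a `k`-node line of `X`: it has degree exactly 1 and passes through exactly
`k` nodes of `X`. -/
def IsKNodeLine (X : Finset (ℝ × ℝ)) (ℓ : Poly2) (k : ℕ) : Prop :=
  ℓ.totalDegree = 1 ∧ (nodesOn X ℓ).card = k

/-- A maximal line of an `n`-poised set: an `(n+1)`-node line. -/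
def IsMaximalLine (n : ℕ) (X : Finset (ℝ × ℝ)) (ℓ : Poly2) : Prop :=
  IsKNodeLine X ℓ (n + 1)

/-- The zero set of a polynomial, i.e. the line it determines when it has degree 1. -/
def zeroSet (ℓ : Poly2) : Set (ℝ × ℝ) := {A | evalPt ℓ A = 0}

/-- `μ(X)`: the number of maximal lines (as subsets of the plane) of `X`. -/
noncomputable def mu (n : ℕ) (X : Finset (ℝ × ℝ)) : ℕ :=
  {L : Set (ℝ × ℝ) | ∃ ℓ : Poly2, IsMaximalLine n X ℓ ∧ L = zeroSet ℓ}.ncard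

/-- The node `A` of `X` uses the line `ℓ`: `ℓ` divides a fundamental polynomial of `A`. -/
def Uses (n : ℕ) (X : Finset (ℝ × ℝ)) (ℓ : Poly2) (A : ℝ × ℝ) : Prop :=
  ∃ p : Poly2, IsFund n X A p ∧ ℓ ∣ p

/-- `X_ℓ`: the set of nodes of `X` using the line `ℓ`. -/
noncomputable def usesSet (n : ℕ) (X : Finset (ℝ × ℝ)) (ℓ : Poly2) : Finset (ℝ × ℝ) :=
  @Finset.filter _ (Uses n X ℓ) (Classical.decPred _) X

/-- The Gasca–Maeztu conjecture for degree `m`: every `GC_m` set has a maximal line. -/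
def GM (m : ℕ) : Prop :=
  ∀ Y : Finset (ℝ × ℝ), IsGC m Y → ∃ lam : Poly2, IsMaximalLine m Y lam

theorem evalPt_mul (p q : Poly2) (A : ℝ × ℝ) : evalPt (p * q) A = evalPt p A * evalPt q A := by
  simp [evalPt]

theorem evalPt_add (p q : Poly2) (A : ℝ × ℝ) : evalPt (p + q) A = evalPt p A + evalPt q A := by
  simp [evalPt]

theorem evalPt_C (c : ℝ) (A : ℝ × ℝ) : evalPt (C c) A = c := by
  simp [evalPt]

theorem mem_nodesOn (X : Finset (ℝ × ℝ)) (ℓ : Poly2) (A : ℝ × ℝ) :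
    A ∈ nodesOn X ℓ ↔ A ∈ X ∧ evalPt ℓ A = 0 := by
  simp [nodesOn]

theorem mem_usesSet (n : ℕ) (X : Finset (ℝ × ℝ)) (ℓ : Poly2) (A : ℝ × ℝ) :
    A ∈ usesSet n X ℓ ↔ A ∈ X ∧ Uses n X ℓ A := by
  simp [usesSet]

/-- A polynomial of degree 1 is a nontrivial affine form. -/
theorem line_form (ℓ : Poly2) (hl : ℓ.totalDegree = 1) :
    ∃ a b c : ℝ, ℓ = C a * X 0 + C b * X 1 + C c ∧ a ^ 2 + b ^ 2 ≠ 0 := by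
  have key : ℓ = C (coeff (Finsupp.single 0 1) ℓ) * X 0 + C (coeff (Finsupp.single 1 1) ℓ) * X 1
      + C (coeff 0 ℓ) := by
    ext m
    by_cases h2 : 1 < m 0 + m 1
    · have h1 : coeff m ℓ = 0 := by
        apply coeff_eq_zero_of_totalDegree_lt
        rw [hl]
        have : ∑ i ∈ m.support, m i = m 0 + m 1 := by
          rw [← Fin.sum_univ_two (f := fun i => m i)]
          apply Finset.sum_subset (Finset.subset_univ _)
          intro i _ hi
          simpa using hi
        rw [this]; exact h2
      rw [h1]
      have e0 : (Finsupp.single 0 1 : Fin 2 →₀ ℕ) ≠ m := by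
        rintro rfl; simp at h2
      have e1 : (Finsupp.single 1 1 : Fin 2 →₀ ℕ) ≠ m := by
        rintro rfl; simp at h2
      have e2 : (0 : Fin 2 →₀ ℕ) ≠ m := by
        rintro rfl; simp at h2
      simp [coeff_X, coeff_C, e0, e1, e2]
    · have : m = 0 ∨ m = Finsupp.single 0 1 ∨ m = Finsupp.single 1 1 := by
        have : (m 0 = 0 ∧ m 1 = 0) ∨ (m 0 = 1 ∧ m 1 = 0) ∨ (m 0 = 0 ∧ m 1 = 1) := by omega
        rcases this with h | h | h
        · left; ext i; fin_cases i <;> simp [h]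
        · right; left; ext i; fin_cases i <;> simp [h]
        · right; right; ext i; fin_cases i <;> simp [h]
      have e01 : (Finsupp.single 0 1 : Fin 2 →₀ ℕ) ≠ Finsupp.single 1 1 := by
        intro h
        have := DFunLike.congr_fun h 0
        simp at this
      have e0 : (Finsupp.single 0 1 : Fin 2 →₀ ℕ) ≠ 0 := by simp
      have e1 : (Finsupp.single 1 1 : Fin 2 →₀ ℕ) ≠ 0 := by simp
      rcases this with rfl | rfl | rfl
      · simp [coeff_X, coeff_C]
      · simp [coeff_X, coeff_C, e01.symm, e0.symm]
      · simp [coeff_X, coeff_C, e01, e1.symm]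
  refine ⟨_, _, _, key, ?_⟩
  intro h
  have ha : coeff (Finsupp.single 0 1) ℓ = 0 := by nlinarith [sq_nonneg (coeff (Finsupp.single 0 1) ℓ), sq_nonneg (coeff (Finsupp.single 1 1) ℓ)]
  have hb : coeff (Finsupp.single 1 1) ℓ = 0 := by nlinarith [sq_nonneg (coeff (Finsupp.single 0 1) ℓ), sq_nonneg (coeff (Finsupp.single 1 1) ℓ)]
  rw [ha, hb] at key
  simp only [map_zero, zero_mul, zero_add] at key
  rw [key, totalDegree_C] at hl
  exact zero_ne_one hl

theorem quot_deg (ℓ q : Poly2) (hl : ℓ.totalDegree = 1) (k : ℕ) (h : (ℓ * q).totalDegree ≤ k) :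
    q.totalDegree ≤ k - 1 := by
  by_cases hq : q = 0
  · simp [hq]
  · have hl0 : ℓ ≠ 0 := by rintro rfl; simp at hl
    rw [totalDegree_mul_of_isDomain hl0 hq] at h
    omega

/-- Substituting congruent values. -/
theorem dvd_sub_aeval (ℓ : Poly2) (f : Fin 2 → Poly2) (hf : ∀ i, ℓ ∣ X i - f i) (p : Poly2) :
    ℓ ∣ p - aeval f p := by
  induction p using MvPolynomial.induction_on with
  | C a => simp
  | add p q hp hq =>
    have := dvd_add hp hq
    rw [map_add]
    convert this using 1; ring
  | mul_X p i hp =>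
    have := dvd_add (hp.mul_right (X i)) ((hf i).mul_left (aeval f p))
    rw [map_mul, aeval_X]
    convert this using 1; ring

theorem div_line (ℓ : Poly2) (hl : ℓ.totalDegree = 1) (p : Poly2) (k : ℕ)
    (hp : p.totalDegree ≤ k) (S : Finset (ℝ × ℝ)) (hS : k < S.card)
    (hSl : ∀ A ∈ S, evalPt ℓ A = 0) (hSp : ∀ A ∈ S, evalPt p A = 0) :
    ∃ q, p = ℓ * q ∧ q.totalDegree ≤ k - 1 := by
  suffices h : ℓ ∣ p by
    obtain ⟨q, rfl⟩ := h
    exact ⟨q, rfl, quot_deg ℓ q hl k hp⟩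
  obtain ⟨a, b, c, hℓ, hD⟩ := line_form ℓ hl
  set D := a ^ 2 + b ^ 2 with hDdef
  have hev : ∀ A, evalPt ℓ A = a * A.1 + b * A.2 + c := by
    intro A; rw [hℓ]; simp [evalPt]
  let T : Poly2 := C (-b / D) * X 0 + C (a / D) * X 1
  let t : ℝ × ℝ → ℝ := fun A => (-b / D) * A.1 + (a / D) * A.2
  let f : Fin 2 → Polynomial ℝ := ![Polynomial.C (-(a * c) / D) + Polynomial.C (-b) * Polynomial.X,
    Polynomial.C (-(b * c) / D) + Polynomial.C a * Polynomial.X]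
  have hfd : ∀ i, (f i).natDegree ≤ 1 := by
    intro i
    fin_cases i <;> simp only [f] <;> simp <;> compute_degree
  let g := aeval f p
  have hg : g.natDegree ≤ k := by
    simpa using aeval_natDegree_le p hp f hfd
  have hgt : ∀ A, evalPt ℓ A = 0 → g.eval (t A) = evalPt p A := by
    intro A hA
    rw [hev] at hA
    have : g.eval (t A) = aeval (fun i => (f i).eval (t A)) p := by
      simp only [g]
      rw [← Polynomial.coe_aeval_eq_eval, ← AlgHom.comp_apply, comp_aeval]
    rw [this, evalPt, aeval_eq_eval]
    refine congrArg (fun v => eval v p) ?_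
    funext i
    have hc : c = - a * A.1 - b * A.2 := by linarith
    fin_cases i
    · simp [f, t, hc]; field_simp; rw [hDdef]; ring
    · simp [f, t, hc]; field_simp; rw [hDdef]; ring
  have hg0 : g = 0 := by
    apply Polynomial.eq_zero_of_natDegree_lt_card_of_eval_eq_zero' g (S.image t)
    · intro x hx
      obtain ⟨A, hA, rfl⟩ := Finset.mem_image.1 hx
      rw [hgt A (hSl A hA), hSp A hA]
    · rw [Finset.card_image_of_injOn]
      · omega
      · intro A hA B hB hAB
        have h1 := hSl A hA
        have h2 := hSl B hB
        rw [hev] at h1 h2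
        simp only [t] at hAB
        field_simp at hAB
        have e1 : D * (A.1 - B.1) = 0 := by
          rw [hDdef]; linear_combination a * h1 - a * h2 - b * hAB
        have e2 : D * (A.2 - B.2) = 0 := by
          rw [hDdef]; linear_combination b * h1 - b * h2 + a * hAB
        have e1' := (mul_eq_zero.1 e1).resolve_left hD
        have e2' := (mul_eq_zero.1 e2).resolve_left hD
        exact Prod.ext (by linarith) (by linarith)
  have hmain := dvd_sub_aeval ℓ (fun i => Polynomial.aeval T (f i)) (by
    have cc : ∀ x y : ℝ, (C x : Poly2) * C y = C (x * y) := fun x y => (C_mul).symm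
    intro i
    have h0 : a / D * a + b / D * b = 1 := by field_simp; rw [hDdef]
    have h0C : (C (a / D) : Poly2) * C a + C (b / D) * C b = 1 := by
      rw [← C_mul, ← C_mul, ← C_add, h0, C_1]
    fin_cases i
    · refine ⟨C (a / D), ?_⟩
      have e1 : (C (-(a * c) / D) : Poly2) = - (C (a / D) * C c) := by
        rw [← C_mul, ← C_neg]; congr 1; ring
      have e2 : (C (-b / D) : Poly2) = - C (b / D) := by
        rw [← C_neg]; congr 1; ring
      have e3 : (C (a / D) : Poly2) * C b = C (b / D) * C a := by
        rw [← C_mul, ← C_mul]; congr 1; ring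
      simp [f, T, hℓ, algebraMap_eq]
      simp only [e1, e2] 
      linear_combination (- X 0) * h0C
    · refine ⟨C (b / D), ?_⟩
      have e1 : (C (-(b * c) / D) : Poly2) = - (C (b / D) * C c) := by
        rw [← C_mul, ← C_neg]; congr 1; ring
      have e2 : (C (-b / D) : Poly2) = - C (b / D) := by
        rw [← C_neg]; congr 1; ring
      simp [f, T, hℓ, algebraMap_eq]
      simp only [e1, e2] 
      linear_combination (- X 1) * h0C) p
  have : aeval (fun i => Polynomial.aeval T (f i)) p = Polynomial.aeval T g := by
    simp only [g]
    rw [← AlgHom.comp_apply (Polynomial.aeval T), comp_aeval]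
  rw [this, hg0, map_zero, sub_zero] at hmain
  exact hmain

theorem line_sub (l m : Poly2) (hl : l.totalDegree = 1) (hm : m.totalDegree = 1)
    (A B : ℝ × ℝ) (hAB : A ≠ B) (hA : evalPt l A = 0) (hB : evalPt l B = 0)
    (hA' : evalPt m A = 0) (hB' : evalPt m B = 0) (P : ℝ × ℝ) (hP : evalPt l P = 0) :
    evalPt m P = 0 := by
  obtain ⟨q, hq, _⟩ := div_line l hl m 1 hm.le {A, B} (by rw [Finset.card_pair hAB]; norm_num)
    (by simp [hA, hB]) (by simp [hA', hB'])
  rw [hq, evalPt_mul, hP, zero_mul]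

theorem line_eq (l m : Poly2) (hl : l.totalDegree = 1) (hm : m.totalDegree = 1)
    (A B : ℝ × ℝ) (hAB : A ≠ B) (hA : evalPt l A = 0) (hB : evalPt l B = 0)
    (hA' : evalPt m A = 0) (hB' : evalPt m B = 0) : zeroSet l = zeroSet m := by
  ext P
  exact ⟨line_sub l m hl hm A B hAB hA hB hA' hB' P, line_sub m l hm hl A B hAB hA' hB' hA hB P⟩

theorem nodesOn_congr (X : Finset (ℝ × ℝ)) (l m : Poly2) (h : zeroSet l = zeroSet m) :
    nodesOn X l = nodesOn X m := by
  ext P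
  rw [mem_nodesOn, mem_nodesOn]
  have : P ∈ zeroSet l ↔ P ∈ zeroSet m := by rw [h]
  exact and_congr_right fun _ => this

theorem exists_fund (n : ℕ) (X : Finset (ℝ × ℝ)) (hX : IsPoised n X) (A : ℝ × ℝ) (hA : A ∈ X) :
    ∃ p, IsFund n X A p := by
  classical
  let S : Finset (Fin 2 →₀ ℕ) :=
    (Finset.range (n + 1)).biUnion fun k => Finset.finsuppAntidiag Finset.univ k
  have hS : S.card = (n + 2).choose 2 := by
    rw [Finset.card_biUnion]
    · simp only [Finset.card_finsuppAntidiag_nat_eq_choose]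
      simp only [Finset.card_univ, Fintype.card_fin]
      induction n with
      | zero => simp
      | succ n ih => 
        clear * -
        induction n with
        | zero => simp [Finset.sum_range_succ]
        | succ n ih =>
          rw [Finset.sum_range_succ, ih]
          have : 2 + (n + 1 + 1) - 1 = n + 3 := by omega
          rw [this, show n + 1 + 1 = n + 2 from rfl, Nat.choose_succ_self_right]
          rw [show n + 2 + 2 = (n + 3) + 1 from rfl, Nat.choose_succ_succ' (n + 3) 1]
          simp; ring
    · intro i _ j _ hij
      rw [Function.onFun, Finset.disjoint_left]
      intro m hm hm'
      rw [Finset.mem_finsuppAntidiag] at hm hm'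
      exact hij (hm.1.symm.trans hm'.1)
  let V := restrictSupport ℝ (S : Set (Fin 2 →₀ ℕ))
  have hdeg : ∀ p ∈ V, totalDegree p ≤ n := by
    intro p hp
    rw [totalDegree, Finset.sup_le_iff]
    intro m hm
    have hmS := (mem_restrictSupport_iff (R := ℝ)).1 hp hm
    simp only [S, Finset.coe_biUnion, Set.mem_iUnion, Finset.mem_coe, Finset.mem_range,
      Finset.mem_finsuppAntidiag] at hmS
    obtain ⟨k, hk, h1, _⟩ := hmS
    have : (m.sum fun _ e => e) = Finset.univ.sum m := by
      apply Finset.sum_subset (Finset.subset_univ _)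
      intro i _ hi
      simpa using hi
    omega
  have bas := basisRestrictSupport ℝ (S : Set (Fin 2 →₀ ℕ))
  have : Module.Finite ℝ V := Module.Finite.of_basis bas
  have hfr : Module.finrank ℝ V = Module.finrank ℝ (X → ℝ) := by
    rw [Module.finrank_eq_card_basis bas, Module.finrank_fintype_fun_eq_card]
    simp [hS, hX.1]
  let L : V →ₗ[ℝ] (X → ℝ) :=
    { toFun := fun p B => evalPt p.1 B.1
      map_add' := by intro p q; funext B; simp [evalPt]
      map_smul' := by intro r q; funext B; simp [evalPt] }
  have hinj : Function.Injective L := by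
    rw [← LinearMap.ker_eq_bot, LinearMap.ker_eq_bot']
    intro p hp
    apply Subtype.ext
    apply hX.2 p.1 (hdeg p.1 p.2)
    intro B hB
    exact congrFun hp ⟨B, hB⟩
  obtain ⟨p, hp⟩ := (LinearMap.injective_iff_surjective_of_finrank_eq_finrank hfr).1 hinj
    (Pi.single ⟨A, hA⟩ 1)
  refine ⟨p.1, hdeg p.1 p.2, ?_, ?_⟩
  · have := congrFun hp ⟨A, hA⟩
    rw [Pi.single_eq_same] at this
    exact this
  · intro B hB hBA
    have := congrFun hp ⟨B, hB⟩
    rw [Pi.single_eq_of_ne (by simpa using hBA)] at this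
    exact this

/-- A common two-step factorisation. -/
theorem div_node (X : Finset (ℝ × ℝ)) (l q : Poly2) (hl : l.totalDegree = 1) (k j : ℕ)
    (hq : q.totalDegree ≤ k) (E : Finset (ℝ × ℝ)) (hE : E.card ≤ j)
    (hc : k + j < (nodesOn X l).card)
    (hv : ∀ B ∈ X, evalPt l B = 0 → B ∉ E → evalPt q B = 0) :
    ∃ r, q = l * r ∧ r.totalDegree ≤ k - 1 := by
  classical
  apply div_line l hl q k hq (nodesOn X l \ E)
  · have := Finset.le_card_sdiff E (nodesOn X l)
    omega
  · intro B hB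
    exact ((mem_nodesOn _ _ _).1 (Finset.mem_sdiff.1 hB).1).2
  · intro B hB
    have := (mem_nodesOn _ _ _).1 (Finset.mem_sdiff.1 hB).1
    exact hv B this.1 this.2 (Finset.mem_sdiff.1 hB).2

theorem use_not_mem (n : ℕ) (hn : 3 ≤ n) (X : Finset (ℝ × ℝ)) 
    (ℓ : Poly2) (hlin : ℓ.totalDegree = 1)
    (m m' : Poly2) (hm : IsMaximalLine n X m) (hm' : IsMaximalLine n X m')
    (O : ℝ × ℝ) 
    (i1 : ∀ B, evalPt m B = 0 → evalPt m' B = 0 → B = O)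
    (i2 : ∀ B, evalPt m B = 0 → evalPt ℓ B = 0 → B = O)
    (i3 : ∀ B, evalPt m' B = 0 → evalPt ℓ B = 0 → B = O)
    (O1 : evalPt ℓ O = 0)
    (A : ℝ × ℝ) (p : Poly2) (hp : IsFund n X A p) (hd : ℓ ∣ p) : evalPt m A ≠ 0 := by
  classical
  intro hmA
  obtain ⟨q, rfl⟩ := hd
  obtain ⟨hdeg, hpA, hv⟩ := hp
  have hq := quot_deg ℓ q hlin n hdeg
  rw [evalPt_mul] at hpA
  have hAO : A ≠ O := by rintro rfl; simp [O1] at hpA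
  obtain ⟨r, rfl, hr⟩ := div_node X m' q hm'.1 (n - 1) 1 hq {O} (by simp)
    (by rw [hm'.2]; omega) (by
      intro B hB hmB hBO
      have := hv B hB (by rintro rfl; exact hAO (i1 _ hmA hmB))
      rw [evalPt_mul] at this
      refine (mul_eq_zero.1 this).resolve_left fun h => hBO ?_
      simpa using i3 B hmB h)
  obtain ⟨s, rfl, hs⟩ := div_node X m r hm.1 (n - 1 - 1) 2 hr {O, A} Finset.card_le_two
    (by rw [hm.2]; omega) (by
      intro B hB hmB hBO
      simp only [Finset.mem_insert, Finset.mem_singleton, not_or] at hBO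
      have := hv B hB hBO.2
      rw [evalPt_mul, evalPt_mul] at this
      refine (mul_eq_zero.1 ((mul_eq_zero.1 this).resolve_left fun h => hBO.1 ?_)).resolve_left
        fun h => hBO.1 ?_
      · exact i2 B hmB h
      · exact i1 B hmB h)
  simp [evalPt_mul, hmA] at hpA

/-- Let `X` be `n`-poised, `ℓ` a line with at least 3 and at most `n` nodes
of `X`, and `λ', λ''` two `ℓ`-adjacent maximal lines. Then
`X_ℓ = (X \ (λ' ∪ λ''))_ℓ`. Moreover, if `ℓ` has exactly `n` nodes, then
`X_ℓ = X \ (λ' ∪ λ'' ∪ ℓ)` and this set is `(n-3)`-poised. -/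
theorem stmt_18 (n : ℕ)
    (X : Finset (ℝ × ℝ)) (hX : IsPoised n X)
    (ℓ : Poly2) (hlin : ℓ.totalDegree = 1)
    (h3 : 3 ≤ (nodesOn X ℓ).card) (hle : (nodesOn X ℓ).card ≤ n)
    (lam' lam'' : Poly2) (hlam' : IsMaximalLine n X lam') (hlam'' : IsMaximalLine n X lam'')
    (hne : zeroSet lam' ≠ zeroSet lam'')
    (hadj : ∃ A ∈ X, evalPt lam' A = 0 ∧ evalPt lam'' A = 0 ∧ evalPt ℓ A = 0) :
    usesSet n X ℓ = usesSet (n - 2) ((X \ nodesOn X lam') \ nodesOn X lam'') ℓ ∧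
    ((nodesOn X ℓ).card = n →
      usesSet n X ℓ = ((X \ nodesOn X lam') \ nodesOn X lam'') \ nodesOn X ℓ ∧
      IsPoised (n - 3) (usesSet n X ℓ)) := by
  classical
  obtain ⟨O, hOX, O1, O2, O3⟩ := hadj
  have hn : 3 ≤ n := h3.trans hle
  have i1 : ∀ B, evalPt lam' B = 0 → evalPt lam'' B = 0 → B = O := by
    intro B h h'
    by_contra hB
    exact hne (line_eq lam' lam'' hlam'.1 hlam''.1 B O hB h O1 h' O2)
  have il : ∀ m, IsMaximalLine n X m → evalPt m O = 0 →
      ∀ B, evalPt m B = 0 → evalPt ℓ B = 0 → B = O := by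
    intro m hm hO B h h'
    by_contra hB
    have := nodesOn_congr X _ _ (line_eq m ℓ hm.1 hlin B O hB h hO h' O3)
    have h2 := hm.2
    rw [this] at h2
    omega
  have i2 := il lam' hlam' O1
  have i3 := il lam'' hlam'' O2
  have memY : ∀ B, B ∈ (X \ nodesOn X lam') \ nodesOn X lam'' ↔
      B ∈ X ∧ evalPt lam' B ≠ 0 ∧ evalPt lam'' B ≠ 0 := by
    intro B
    simp only [Finset.mem_sdiff, mem_nodesOn]
    tauto
  set Y := (X \ nodesOn X lam') \ nodesOn X lam'' with hY
  have part1 : usesSet n X ℓ = usesSet (n - 2) Y ℓ := by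
    ext A
    rw [mem_usesSet, mem_usesSet, memY]
    constructor
    · rintro ⟨hAX, p, hp, hd⟩
      have n1 := use_not_mem n hn X ℓ hlin lam' lam'' hlam' hlam'' O i1 i2 i3 O3 A p hp hd
      have n2 := use_not_mem n hn X ℓ hlin lam'' lam' hlam'' hlam' O
        (fun B h h' => i1 B h' h) i3 i2 O3 A p hp hd
      refine ⟨⟨hAX, n1, n2⟩, ?_⟩
      obtain ⟨q, rfl⟩ := hd
      obtain ⟨hdeg, hpA, hv⟩ := hp
      have hq := quot_deg ℓ q hlin n hdeg
      obtain ⟨r, rfl, hr⟩ := div_node X lam' q hlam'.1 (n - 1) 1 hq {O} (by simp)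
        (by rw [hlam'.2]; omega) (by
          intro B hB hmB hBO
          have := hv B hB (by rintro rfl; exact n1 hmB)
          rw [evalPt_mul] at this
          refine (mul_eq_zero.1 this).resolve_left fun h => hBO ?_
          simpa using i2 B hmB h)
      obtain ⟨s, rfl, hs⟩ := div_node X lam'' r hlam''.1 (n - 1 - 1) 1 hr {O} (by simp)
        (by rw [hlam''.2]; omega) (by
          intro B hB hmB hBO
          have := hv B hB (by rintro rfl; exact n2 hmB)
          rw [evalPt_mul, evalPt_mul] at this
          rw [Finset.mem_singleton] at hBO
          refine (mul_eq_zero.1 ((mul_eq_zero.1 this).resolve_left fun h => hBO ?_)).resolve_left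
            fun h => hBO ?_
          · exact i3 B hmB h
          · exact i1 B h hmB)
      refine ⟨ℓ * (s * C (evalPt lam' A * evalPt lam'' A)), ⟨?_, ?_, ?_⟩, dvd_mul_right _ _⟩
      · have h1 := totalDegree_mul ℓ (s * C (evalPt lam' A * evalPt lam'' A))
        have h2 := totalDegree_mul s (C (evalPt lam' A * evalPt lam'' A))
        rw [totalDegree_C] at h2
        omega
      · rw [← hpA]; simp only [evalPt_mul, evalPt_C]; ring
      · intro B hB hBA
        obtain ⟨hBX, b1, b2⟩ := (memY B).1 hB
        have := hv B hBX hBA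
        simp only [evalPt_mul] at this ⊢
        simp only [mul_eq_zero, b1, b2, false_or] at this
        rcases this with h | h <;> simp [h]
    · rintro ⟨⟨hAX, n1, n2⟩, p, ⟨hdeg, hpA, hv⟩, hd⟩
      refine ⟨hAX, lam' * (lam'' * (p * C (evalPt lam' A * evalPt lam'' A)⁻¹)), ⟨?_, ?_, ?_⟩, ?_⟩
      · have h1 := totalDegree_mul lam' (lam'' * (p * C (evalPt lam' A * evalPt lam'' A)⁻¹))
        have h2 := totalDegree_mul lam'' (p * C (evalPt lam' A * evalPt lam'' A)⁻¹)
        have h3 := totalDegree_mul p (C (evalPt lam' A * evalPt lam'' A)⁻¹)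
        rw [totalDegree_C] at h3
        have := hlam'.1
        have := hlam''.1
        omega
      · simp only [evalPt_mul, evalPt_C, hpA]; field_simp
      · intro B hB hBA
        simp only [evalPt_mul]
        by_cases b1 : evalPt lam' B = 0
        · simp [b1]
        by_cases b2 : evalPt lam'' B = 0
        · simp [b2]
        simp [hv B ((memY B).2 ⟨hB, b1, b2⟩) hBA]
      · exact ((hd.mul_right _).mul_left _).mul_left _
  refine ⟨part1, fun hcard => ?_⟩
  have part2 : usesSet n X ℓ = Y \ nodesOn X ℓ := by
    ext A
    rw [Finset.mem_sdiff, mem_nodesOn]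
    constructor
    · intro h
      have h' := h
      rw [part1] at h'
      refine ⟨((mem_usesSet _ _ _ _).1 h').1, fun h0 => ?_⟩
      obtain ⟨_, p, ⟨_, hpA, _⟩, q, rfl⟩ := (mem_usesSet _ _ _ _).1 h
      rw [evalPt_mul, h0.2, zero_mul] at hpA
      exact zero_ne_one hpA
    · rintro ⟨hAY, hA3⟩
      obtain ⟨hAX, n1, n2⟩ := (memY A).1 hAY
      have n3 : evalPt ℓ A ≠ 0 := fun h => hA3 ⟨hAX, h⟩
      rw [mem_usesSet]
      refine ⟨hAX, ?_⟩
      obtain ⟨p, hp⟩ := exists_fund n X hX A hAX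
      refine ⟨p, hp, ?_⟩
      obtain ⟨hdeg, hpA, hv⟩ := hp
      obtain ⟨q, rfl, hq⟩ := div_node X lam' p hlam'.1 n 0 hdeg ∅ (by simp)
        (by rw [hlam'.2]; omega) (by
          intro B hB hmB _
          exact hv B hB (by rintro rfl; exact n1 hmB))
      obtain ⟨r, rfl, hr⟩ := div_node X lam'' q hlam''.1 (n - 1) 1 hq {O} (by simp)
        (by rw [hlam''.2]; omega) (by
          intro B hB hmB hBO
          have := hv B hB (by rintro rfl; exact n2 hmB)
          rw [evalPt_mul] at this
          refine (mul_eq_zero.1 this).resolve_left fun h => hBO ?_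
          simpa using i1 B h hmB)
      obtain ⟨s, rfl, hs⟩ := div_node X ℓ r hlin (n - 1 - 1) 1 hr {O} (by simp)
        (by rw [hcard]; omega) (by
          intro B hB hmB hBO
          have := hv B hB (by rintro rfl; exact n3 hmB)
          rw [evalPt_mul, evalPt_mul] at this
          rw [Finset.mem_singleton] at hBO
          refine (mul_eq_zero.1 ((mul_eq_zero.1 this).resolve_left fun h => hBO ?_)).resolve_left
            fun h => hBO ?_
          · exact i2 B h hmB
          · exact i3 B h hmB)
      exact ((dvd_mul_right _ _).mul_left _).mul_left _
  refine ⟨part2, ?_⟩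
  rw [part2]
  constructor
  · have c1 : (X \ nodesOn X lam').card + (nodesOn X lam').card = X.card :=
      Finset.card_sdiff_add_card_eq_card (fun B hB => ((mem_nodesOn _ _ _).1 hB).1)
    have e2 : Y = (X \ nodesOn X lam') \ (nodesOn X lam'').erase O := by
      rw [hY]; ext B
      simp only [Finset.mem_sdiff, mem_nodesOn, Finset.mem_erase]
      constructor
      · tauto
      · rintro ⟨⟨h1, h2⟩, h4⟩
        refine ⟨⟨h1, h2⟩, fun h => h4 ⟨?_, h⟩⟩
        rintro rfl
        exact h2 ⟨hOX, O1⟩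
    have c2 : Y.card + ((nodesOn X lam'').erase O).card = (X \ nodesOn X lam').card := by
      rw [e2]
      apply Finset.card_sdiff_add_card_eq_card
      intro B hB
      rw [Finset.mem_erase, mem_nodesOn] at hB
      rw [Finset.mem_sdiff, mem_nodesOn]
      exact ⟨hB.2.1, fun h => hB.1 (i1 B h.2 hB.2.2)⟩
    have e3 : Y \ nodesOn X ℓ = Y \ (nodesOn X ℓ).erase O := by
      ext B
      simp only [Finset.mem_sdiff, mem_nodesOn, Finset.mem_erase]
      constructor
      · tauto
      · rintro ⟨h2, h4⟩
        refine ⟨h2, fun h => h4 ⟨?_, h⟩⟩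
        rintro rfl
        exact ((memY _).1 h2).2.1 O1
    have c3 : (Y \ nodesOn X ℓ).card + ((nodesOn X ℓ).erase O).card = Y.card := by
      rw [e3]
      apply Finset.card_sdiff_add_card_eq_card
      intro B hB
      rw [Finset.mem_erase, mem_nodesOn] at hB
      rw [memY]
      exact ⟨hB.2.1, fun h => hB.1 (i2 B h hB.2.2), fun h => hB.1 (i3 B h hB.2.2)⟩
    rw [Finset.card_erase_of_mem ((mem_nodesOn _ _ _).2 ⟨hOX, O2⟩), hlam''.2] at c2
    rw [Finset.card_erase_of_mem ((mem_nodesOn _ _ _).2 ⟨hOX, O3⟩), hcard] at c3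
    rw [hlam'.2, hX.1] at c1
    obtain ⟨m, rfl⟩ := Nat.exists_eq_add_of_le' hn
    have k1 := Nat.choose_succ_succ' (m + 4) 1
    have k2 := Nat.choose_succ_succ' (m + 3) 1
    have k3 := Nat.choose_succ_succ' (m + 2) 1
    simp only [Nat.choose_one_right, Nat.reduceAdd, add_assoc] at k1 k2 k3 c1
    simp only [Nat.add_sub_cancel]
    omega
  · intro p hp hv
    have hz : ∀ m : Poly2, m.totalDegree = 1 → m ≠ 0 := by rintro m h rfl; simp at h
    have h0 : lam' * (lam'' * (ℓ * p)) = 0 := by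
      apply hX.2
      · have h1 := totalDegree_mul lam' (lam'' * (ℓ * p))
        have h2 := totalDegree_mul lam'' (ℓ * p)
        have h3 := totalDegree_mul ℓ p
        have := hlam'.1
        have := hlam''.1
        omega
      · intro B hB
        simp only [evalPt_mul]
        by_cases b1 : evalPt lam' B = 0
        · simp [b1]
        by_cases b2 : evalPt lam'' B = 0
        · simp [b2]
        by_cases b3 : evalPt ℓ B = 0
        · simp [b3]
        rw [hv B]
        · simp
        · rw [Finset.mem_sdiff, memY, mem_nodesOn]
          exact ⟨⟨hB, b1, b2⟩, fun h => b3 h.2⟩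
    simpa [hz _ hlam'.1, hz _ hlam''.1, hz _ hlin] using h0
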